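/- Logarithmic moment of sub-eigenfunctions: let v : ℝ → [0,∞) be Borel measurable with ∫_ℝ v(x)² μ(dx) < ∞, and suppose there exists a constant C > 0 such that v(x) ≤ C ∑_{n∈ℕ} ∫_ℝ f^p_{x,y}(n) v(y) μ(dy) for every x ∈ ℝ. Then ∫_ℝ v(x) log(max(x², 1)) μ(dx) < ∞. -/

import Mathlib

open MeasureTheory Filter Topology Set
open scoped ENNReal NNReal BigOperators

noncomputable section

/-- The configuration `φ_{-1} = x, φ_0 = 0, (φ_1,…,φ_{n-2}) = w, φ_{n-1} = y, φ_n = 0`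
extended to `ℤ`. -/
def fExt (x y : ℝ) (n : ℕ) (w : Fin (n - 2) → ℝ) (i : ℤ) : ℝ :=
  if h1 : i ≤ -1 then x
  else if h2 : i = 0 then 0
  else if h : i ≤ (n : ℤ) - 2 then w ⟨i.toNat - 1, by omega⟩
  else if i = (n : ℤ) - 1 then y else 0

/-- the pinning density `f^p_{x,y}(n)` -/
def fpin (E : ℝ → ℝ) (x y : ℝ) (n : ℕ) : ℝ :=
  if n = 1 then (if y = 0 then E x else 0)
  else if y = 0 then 0
  else ∫ w : Fin (n - 2) → ℝ,
    ∏ m ∈ Finset.Icc (0 : ℤ) ((n : ℤ) - 1),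
      E (fExt x y n w (m + 1) + fExt x y n w (m - 1) - 2 * fExt x y n w m)

/-- the wetting density `f^w_{x,y}(n)` -/
def fwet (E : ℝ → ℝ) (x y : ℝ) (n : ℕ) : ℝ :=
  if 0 ≤ x ∧ 0 ≤ y then
    (if n = 1 then (if y = 0 then E x else 0)
    else if y = 0 then 0
    else ∫ w in {w : Fin (n - 2) → ℝ | ∀ i, 0 ≤ w i},
      ∏ m ∈ Finset.Icc (0 : ℤ) ((n : ℤ) - 1),
        E (fExt x y n w (m + 1) + fExt x y n w (m - 1) - 2 * fExt x y n w m))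
  else 0

/-- the reference measure `μ(dx) = δ_0(dx) + dx` on `ℝ` -/
def muK : Measure ℝ := Measure.dirac 0 + volume

open scoped FourierTransform Convolution

theorem integral_gaussian_mul_fourier {f : ℝ → ℂ} (hf : Integrable f) {c : ℝ} (hc : 0 < c) :
    ∫ w : ℝ, Complex.exp (-c⁻¹ * ‖w‖ ^ 2) • 𝓕 f w =
      ∫ w : ℝ, ((Real.pi * c : ℂ) ^ (Module.finrank ℝ ℝ / 2 : ℂ) *
        Complex.exp (-Real.pi ^ 2 * c * ‖(0 : ℝ) - w‖ ^ 2)) • f w := by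
  have J : Integrable (fun w : ℝ ↦ Complex.exp (-c⁻¹ * ‖w‖ ^ 2 +
      2 * Real.pi * Complex.I * (inner ℝ (0 : ℝ) w : ℝ))) :=
    GaussianFourier.integrable_cexp_neg_mul_sq_norm_add (by simpa) _ _
  have h := (VectorFourier.integral_fourierIntegral_smul_eq_flip (L := innerₗ ℝ)
      Real.continuous_fourierChar continuous_inner J hf).symm
  calc _ = ∫ w : ℝ, 𝓕 (fun w : ℝ ↦ Complex.exp (-c⁻¹ * ‖w‖ ^ 2 +
      2 * Real.pi * Complex.I * (inner ℝ (0 : ℝ) w : ℝ))) w • f w := by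
        simpa using! h
    _ = _ := by
      congr with w
      rw [fourier_gaussian_innerProductSpace' (by simpa)]
      congr
      · simp
      · simp; ring

theorem continuous_fourier_of_integrable {f : ℝ → ℂ} (hf : Integrable f) : Continuous (𝓕 f) :=
  VectorFourier.fourierIntegral_continuous (L := innerₗ ℝ) (μ := volume)
    Real.continuous_fourierChar (by exact continuous_inner) hf

theorem integrable_of_fourier_nonneg {f : ℝ → ℂ} (hf : Integrable f) (hc : ContinuousAt f 0)
    {g : ℝ → ℝ} (hg : ∀ ξ, 0 ≤ g ξ) (hfg : ∀ ξ, 𝓕 f ξ = g ξ) : Integrable g := by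
  have hgc : Continuous g := by
    have h2 : g = fun ξ => (𝓕 f ξ).re := by ext ξ; simp [hfg]
    rw [h2]; exact Complex.continuous_re.comp (continuous_fourier_of_integrable hf)
  have T := (Real.tendsto_integral_gaussian_smul' hf hc).comp tendsto_natCast_atTop_atTop
  have T2 : Tendsto (fun n : ℕ => ‖∫ w : ℝ, Complex.exp (-((n:ℝ):ℂ)⁻¹ * ‖w‖ ^ 2) • 𝓕 f w‖) atTop
      (𝓝 ‖f 0‖) := by
    refine T.norm.congr' ?_
    filter_upwards [eventually_gt_atTop 0] with n hn
    have hn' : (0:ℝ) < n := by exact_mod_cast hn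
    simp only [Function.comp]
    rw [← integral_gaussian_mul_fourier hf hn']
    push_cast
    rfl
  have key : ∀ n : ℕ, 0 < n → ∫⁻ w, ENNReal.ofReal (Real.exp (-(n:ℝ)⁻¹ * w ^ 2) * g w) =
      ENNReal.ofReal ‖∫ w : ℝ, Complex.exp (-((n:ℝ):ℂ)⁻¹ * ‖w‖ ^ 2) • 𝓕 f w‖ := by
    intro n hn
    have hn' : (0:ℝ) < n := by exact_mod_cast hn
    have h1 : (fun w : ℝ => Complex.exp (-((n:ℝ):ℂ)⁻¹ * ‖w‖ ^ 2) • 𝓕 f w) =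
        fun w => ((Real.exp (-(n:ℝ)⁻¹ * w ^ 2) * g w : ℝ) : ℂ) := by
      ext w
      rw [hfg]
      push_cast
      rw [smul_eq_mul]
      congr 3
      norm_cast
      simp
    have hi : Integrable (fun w => Real.exp (-(n:ℝ)⁻¹ * w ^ 2) * g w) := by
      refine (integrable_exp_neg_mul_sq (b := (n:ℝ)⁻¹) (by positivity)).mul_bdd
        (c := ∫ x, ‖f x‖)
        hgc.aestronglyMeasurable (ae_of_all _ fun w => ?_)
      have : ‖g w‖ = ‖𝓕 f w‖ := by rw [hfg]; simp
      rw [this]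
      exact VectorFourier.norm_fourierIntegral_le_integral_norm _ _ _ _ _
    rw [h1, integral_complex_ofReal, Complex.norm_real, Real.norm_of_nonneg,
      ofReal_integral_eq_lintegral_ofReal hi]
    · exact ae_of_all _ fun w => mul_nonneg (Real.exp_nonneg _) (hg _)
    · exact integral_nonneg fun w => mul_nonneg (Real.exp_nonneg _) (hg _)
  have hlim : ∀ w, Tendsto (fun n : ℕ => ENNReal.ofReal (Real.exp (-(n:ℝ)⁻¹ * w ^ 2) * g w)) atTop
      (𝓝 (ENNReal.ofReal (g w))) := by
    intro w
    apply ENNReal.tendsto_ofReal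
    have : Tendsto (fun n : ℕ => Real.exp (-(n:ℝ)⁻¹ * w ^ 2) * g w) atTop
      (𝓝 (Real.exp (-0 * w ^ 2) * g w)) := by
      have := (tendsto_inv_atTop_zero (𝕜 := ℝ)).comp (tendsto_natCast_atTop_atTop (R := ℝ))
      exact ((this.neg.mul_const _).rexp).mul_const _
    simpa using this
  refine ⟨hgc.aestronglyMeasurable, ?_⟩
  rw [hasFiniteIntegral_iff_ofReal (ae_of_all _ hg)]
  calc ∫⁻ w, ENNReal.ofReal (g w)
      = ∫⁻ w, liminf (fun n : ℕ => ENNReal.ofReal (Real.exp (-(n:ℝ)⁻¹ * w ^ 2) * g w)) atTop := by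
        congr with w; exact (hlim w).liminf_eq.symm
    _ ≤ liminf (fun n : ℕ => ∫⁻ w, ENNReal.ofReal (Real.exp (-(n:ℝ)⁻¹ * w ^ 2) * g w)) atTop :=
        lintegral_liminf_le fun n => by fun_prop
    _ = ENNReal.ofReal ‖f 0‖ := by
        refine Tendsto.liminf_eq ?_
        refine (ENNReal.tendsto_ofReal T2).congr' ?_
        filter_upwards [eventually_gt_atTop 0] with n hn
        exact (key n hn).symm
    _ < ⊤ := ENNReal.ofReal_lt_top

/-- The Fourier transform of a bounded continuous integrable function is square integrable. -/
theorem integrable_norm_fourier_sq {E : ℝ → ℝ} (hE : Integrable E) (hc : Continuous E)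
    {M : ℝ} (hM : ∀ x, |E x| ≤ M) :
    Integrable (fun ξ => ‖𝓕 (fun x => (E x : ℂ)) ξ‖ ^ 2) := by
  set f : ℝ → ℂ := fun x => (E x : ℂ) with hf
  have hfi : Integrable f := hE.ofReal
  have hfi' : Integrable (fun x => f (-x)) := hfi.comp_neg
  have hfc : Continuous f := Complex.continuous_ofReal.comp hc
  refine integrable_of_fourier_nonneg (f := f ⋆[ContinuousLinearMap.mul ℂ ℂ] (fun x => f (-x)))
    (hfi.integrable_convolution _ hfi') ?_ (fun ξ => by positivity) ?_
  · refine Continuous.continuousAt ?_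
    refine BddAbove.continuous_convolution_right_of_integrable _ ⟨M, ?_⟩ hfi (by fun_prop)
    rintro _ ⟨x, rfl⟩
    simpa [hf] using hM (-x)
  · intro ξ
    rw [Real.fourier_mul_convolution_eq hfi hfi']
    have : 𝓕 (fun x => f (-x)) ξ = (starRingEnd ℂ) (𝓕 f ξ) := by
      rw [Real.fourier_real_eq_integral_exp_smul, Real.fourier_real_eq_integral_exp_smul,
        ← integral_conj, ← integral_neg_eq_self]
      congr with x
      have h2 : (starRingEnd ℂ) 2 = 2 := Complex.conj_ofNat 2
      simp [hf, ← Complex.exp_conj, h2]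
    rw [this, Complex.mul_conj, Complex.normSq_eq_norm_sq]

theorem abs_sin_le_sub (u : ℝ) : |Real.sin u| ≤ |u| * (1 - min (u ^ 2) 1 / 20) := by
  wlog hu : 0 ≤ u generalizing u
  · simpa using this (-u) (by linarith)
  rw [abs_of_nonneg hu]
  have hsb := fun x hx => (abs_le.1 (Real.sin_bound (x := x) hx)).2
  rcases le_total u 1 with h | h
  · have h0 : 0 ≤ Real.sin u := Real.sin_nonneg_of_nonneg_of_le_pi hu (by linarith [Real.pi_gt_three])
    rw [abs_of_nonneg h0, min_eq_left (by nlinarith)]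
    have := hsb u (by rwa [abs_of_nonneg hu])
    rw [abs_of_nonneg hu] at this
    have h3 : u ^ 4 ≤ u ^ 3 := pow_le_pow_of_le_one hu h (by norm_num)
    have : 0 ≤ u ^ 3 := by positivity
    nlinarith
  · rw [min_eq_right (by nlinarith)]
    rcases le_total 2 u with h2 | h2
    · linarith [Real.abs_sin_le_one u]
    · have h0 : 0 ≤ Real.sin u :=
        Real.sin_nonneg_of_nonneg_of_le_pi hu (by linarith [Real.pi_gt_three])
      rw [abs_of_nonneg h0]
      have h1 := hsb 1 (by simp)
      have hl : Real.sin u - Real.sin 1 ≤ u - 1 := by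
        have := Real.lipschitzWith_sin.dist_le_mul u 1
        rw [Real.dist_eq, Real.dist_eq, abs_of_nonneg (by linarith : 0 ≤ u - 1)] at this
        simpa using (le_abs_self _).trans this
      norm_num at h1
      linarith

theorem norm_fourier_le_exp {E : ℝ → ℝ} (hE : Integrable E) (hc : Continuous E)
    (hn : ∀ x, 0 ≤ E x) (h0 : 0 < E 0) (h1 : ∫ x, E x = 1) :
    ∃ κ > 0, ∀ ξ, ‖𝓕 (fun x => (E x : ℂ)) ξ‖ ≤ Real.exp (-κ * min (ξ ^ 2) 1) := by
  obtain ⟨r, hr, hr'⟩ : ∃ r > 0, ∀ x ∈ Ioc (-r) r, E 0 / 2 ≤ E x := by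
    have := (hc.tendsto 0).eventually (lt_mem_nhds (half_lt_self h0))
    obtain ⟨r, hr, h⟩ := Metric.eventually_nhds_iff.1 this
    refine ⟨r / 2, by positivity, fun x hx => (h ?_).le⟩
    rw [Real.dist_eq, sub_zero, abs_lt]
    constructor <;> linarith [hx.1, hx.2]
  set c := E 0 / 2 with hc'
  have hc0 : 0 < c := by positivity
  set b : ℝ → ℝ := (Ioc (-r) r).indicator fun _ => c with hb
  have hbi : Integrable b := (integrable_indicator_iff measurableSet_Ioc).2
    (by simp [integrableOn_const_iff])
  have hbint : ∫ x, b x = 2 * r * c := by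
    rw [hb, integral_indicator measurableSet_Ioc]
    simp [two_mul, hr.le, Measure.real]
  have hbE : ∀ x, b x ≤ E x := by
    intro x
    by_cases hx : x ∈ Ioc (-r) r
    · simpa [hb, hx] using hr' x hx
    · simpa [hb, hx] using hn x
  have hrc : 2 * r * c ≤ 1 := by
    rw [← hbint, ← h1]; exact integral_mono hbi hE hbE
  have hFb : ∀ ξ, ‖𝓕 (fun x => (b x : ℂ)) ξ‖ ≤
      2 * r * c * (1 - min ((2 * Real.pi * r * ξ) ^ 2) 1 / 20) := by
    intro ξ
    rcases eq_or_ne ξ 0 with rfl | hξ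
    · refine (VectorFourier.norm_fourierIntegral_le_integral_norm _ _ _ _ _).trans ?_
      have : ∫ x, ‖(b x : ℂ)‖ = 2 * r * c := by
        rw [← hbint]
        refine integral_congr_ae (ae_of_all _ fun x => ?_)
        simp only [Complex.norm_real]
        exact Real.norm_of_nonneg (indicator_nonneg (fun _ _ => hc0.le) x)
      simp only [this]
      simp
    have hI : 𝓕 (fun x => (b x : ℂ)) ξ = c * ∫ x in (-r)..r, Complex.exp (-(2 * Real.pi * ξ * Complex.I) * x) := by
      rw [Real.fourier_real_eq_integral_exp_smul, intervalIntegral.integral_of_le (by linarith),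
        ← integral_const_mul, ← integral_indicator measurableSet_Ioc]
      congr with x
      by_cases hx : x ∈ Ioc (-r) r
      · simp only [hb, hx, indicator_of_mem, smul_eq_mul]
        rw [mul_comm]
        congr 2
        push_cast
        ring
      · simp [hb, hx]
    have hI2 : (∫ x in (-r)..r, Complex.exp (-(2 * Real.pi * ξ * Complex.I) * x)) =
        ((Real.sin (2 * Real.pi * r * ξ) / (Real.pi * ξ) : ℝ) : ℂ) := by
      have hpi : (Real.pi : ℂ) ≠ 0 := by exact_mod_cast Real.pi_ne_zero
      have hξ' : (ξ : ℂ) ≠ 0 := by exact_mod_cast hξ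
      rw [integral_exp_mul_complex (by simp [hξ, Real.pi_ne_zero])]
      push_cast
      rw [Complex.sin]
      field_simp
      rw [Complex.I_sq]
      ring_nf
    rw [hI, hI2, norm_mul, Complex.norm_real, Complex.norm_real, Real.norm_of_nonneg hc0.le,
      norm_div, Real.norm_eq_abs, Real.norm_eq_abs]
    have hs := abs_sin_le_sub (2 * Real.pi * r * ξ)
    have hpos : 0 < |Real.pi * ξ| := by positivity
    have habs : |2 * Real.pi * r * ξ| = 2 * r * |Real.pi * ξ| := by
      rw [show 2 * Real.pi * r * ξ = (2 * r) * (Real.pi * ξ) by ring, abs_mul,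
        abs_of_pos (by positivity : 0 < 2 * r)]
    rw [habs] at hs
    calc c * (|Real.sin (2 * Real.pi * r * ξ)| / |Real.pi * ξ|) ≤
        c * (2 * r * (1 - min ((2 * Real.pi * r * ξ) ^ 2) 1 / 20)) := by
          gcongr
          rw [div_le_iff₀ hpos]
          linarith
      _ = _ := by ring
  have hmin : ∀ ξ : ℝ, min ((2 * Real.pi * r) ^ 2) 1 * min (ξ ^ 2) 1 ≤
      min ((2 * Real.pi * r * ξ) ^ 2) 1 := by
    intro ξ
    rw [mul_pow _ ξ]
    refine le_min ?_ ?_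
    · gcongr <;> exact min_le_left _ _
    · exact mul_le_one₀ (min_le_right _ _) (le_min (by positivity) zero_le_one) (min_le_right _ _)
  refine ⟨2 * r * c * min ((2 * Real.pi * r) ^ 2) 1 / 20, by positivity, fun ξ => ?_⟩
  have hsplit : 𝓕 (fun x => (E x : ℂ)) ξ =
      𝓕 (fun x => ((E x - b x : ℝ) : ℂ)) ξ + 𝓕 (fun x => (b x : ℂ)) ξ := by
    have hadd := congrFun (VectorFourier.fourierIntegral_add (L := innerₗ ℝ) (μ := volume)
      Real.continuous_fourierChar (by exact continuous_inner)
      (f := fun x => ((E x - b x : ℝ) : ℂ)) ((hE.sub hbi).ofReal (𝕜 := ℂ))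
      (hbi.ofReal (𝕜 := ℂ))) ξ
    have hfun : (fun x => (E x : ℂ)) = (fun x => ((E x - b x : ℝ) : ℂ)) + fun x => (b x : ℂ) := by
      ext x; simp
    rw [hfun]
    exact hadd
  have hrest : ‖𝓕 (fun x => ((E x - b x : ℝ) : ℂ)) ξ‖ ≤ 1 - 2 * r * c := by
    refine (VectorFourier.norm_fourierIntegral_le_integral_norm _ _ _ _ _).trans ?_
    rw [← hbint, ← h1, ← integral_sub hE hbi]
    refine le_of_eq (integral_congr_ae (ae_of_all _ fun x => ?_))
    simp only [Complex.norm_real]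
    exact Real.norm_of_nonneg (sub_nonneg.2 (hbE x))
  calc ‖𝓕 (fun x => (E x : ℂ)) ξ‖ ≤ (1 - 2 * r * c) +
        2 * r * c * (1 - min ((2 * Real.pi * r * ξ) ^ 2) 1 / 20) := by
        rw [hsplit]; exact (norm_add_le _ _).trans (add_le_add hrest (hFb ξ))
    _ ≤ (-(2 * r * c * min ((2 * Real.pi * r) ^ 2) 1 / 20) * min (ξ ^ 2) 1) + 1 := by
        have := mul_le_mul_of_nonneg_left (hmin ξ) (by positivity : 0 ≤ 2 * r * c)
        linarith
    _ ≤ _ := Real.add_one_le_exp _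

theorem integral_mul_comp_sub_mul_eq_convolution {f g : ℝ → ℝ} {a : ℝ} (ha : 0 < a) :
    (fun z => ∫ t, f t * g (z - a * t)) =
      (fun u => a⁻¹ * f (u / a)) ⋆[ContinuousLinearMap.mul ℝ ℝ] g := by
  ext z
  rw [convolution_def]
  have := Measure.integral_comp_div (fun t => f t * g (z - a * t)) a
  rw [abs_of_pos ha, smul_eq_mul, ← inv_mul_eq_iff_eq_mul₀ ha.ne'] at this
  rw [← this, ← integral_const_mul]
  congr with u
  rw [mul_div_cancel₀ _ ha.ne']
  simp [mul_assoc]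

theorem integrable_inv_mul_comp_div {f : ℝ → ℝ} (hf : Integrable f) {a : ℝ} (ha : 0 < a) :
    Integrable (fun u => a⁻¹ * f (u / a)) :=
  (hf.comp_div ha.ne').const_mul _

theorem fourier_integral_mul_comp_sub_mul {f g : ℝ → ℝ} (hf : Integrable f) (hg : Integrable g)
    {a : ℝ} (ha : 0 < a) (ξ : ℝ) :
    𝓕 (fun z => ((∫ t, f t * g (z - a * t) : ℝ) : ℂ)) ξ =
      𝓕 (fun t => (f t : ℂ)) (a * ξ) * 𝓕 (fun t => (g t : ℂ)) ξ := by
  have hfa : Integrable (fun u => ((a⁻¹ * f (u / a) : ℝ) : ℂ)) :=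
    (integrable_inv_mul_comp_div hf ha).ofReal
  have h1 : (fun z => ((∫ t, f t * g (z - a * t) : ℝ) : ℂ)) =
      (fun u => ((a⁻¹ * f (u / a) : ℝ) : ℂ)) ⋆[ContinuousLinearMap.mul ℂ ℂ]
        (fun u => (g u : ℂ)) := by
    ext z
    have := congrFun (integral_mul_comp_sub_mul_eq_convolution (f := f) (g := g) ha) z
    rw [this, convolution_def, convolution_def, ← integral_complex_ofReal]
    simp
  rw [h1]
  refine (Real.fourier_mul_convolution_eq hfa (hg.ofReal (𝕜 := ℂ)) ξ).trans ?_
  congr 1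
  rw [Real.fourier_real_eq_integral_exp_smul, Real.fourier_real_eq_integral_exp_smul]
  have := Measure.integral_comp_div
    (fun t : ℝ => Complex.exp (↑(-2 * Real.pi * t * (a * ξ)) * Complex.I) • (f t : ℂ)) a
  rw [abs_of_pos ha, Complex.real_smul,
    ← inv_mul_eq_iff_eq_mul₀ (by exact_mod_cast ha.ne')] at this
  rw [← this, ← integral_const_mul]
  congr with u
  have h2 : -2 * Real.pi * (u / a) * (a * ξ) = -2 * Real.pi * u * ξ := by field_simp
  rw [h2]
  push_cast
  simp only [smul_eq_mul]
  ring

/-- `weightedDensity E k` is the density of `∑_{j=1}^{k+1} j t_j`, where the `t_j` are independent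
with density `E`. -/
def weightedDensity (E : ℝ → ℝ) : ℕ → ℝ → ℝ
  | 0 => E
  | k + 1 => fun z => ∫ t, E t * weightedDensity E k (z - (k + 2) * t)

section weightedDensity

variable {E : ℝ → ℝ} {M : ℝ}

theorem weightedDensity_nonneg (hn : ∀ x, 0 ≤ E x) (k : ℕ) (z : ℝ) :
    0 ≤ weightedDensity E k z := by
  induction k generalizing z with
  | zero => exact hn z
  | succ k ih => exact integral_nonneg fun t => mul_nonneg (hn t) (ih _)

theorem weightedDensity_regularity (hn : ∀ x, 0 ≤ E x) (hc : Continuous E) (hM : ∀ x, E x ≤ M)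
    (hE : Integrable E) (h1 : ∫ x, E x = 1) (k : ℕ) :
    Continuous (weightedDensity E k) ∧ Integrable (weightedDensity E k) ∧
      ∀ z, weightedDensity E k z ≤ M := by
  induction k with
  | zero => exact ⟨hc, hE, hM⟩
  | succ k ih =>
    obtain ⟨hc', hi', hM'⟩ := ih
    have hk : (0 : ℝ) < k + 2 := by positivity
    have hbd : ∀ z, ‖weightedDensity E k z‖ ≤ M := fun z => by
      rw [Real.norm_of_nonneg (weightedDensity_nonneg hn k z)]; exact hM' z
    have hrep : weightedDensity E (k + 1) = _ :=
      integral_mul_comp_sub_mul_eq_convolution (f := E) (g := weightedDensity E k) hk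
    refine ⟨?_, ?_, fun z => ?_⟩
    · rw [hrep]
      refine BddAbove.continuous_convolution_right_of_integrable _ ⟨M, ?_⟩
        (integrable_inv_mul_comp_div hE hk) hc'
      rintro _ ⟨x, rfl⟩
      exact hbd x
    · rw [hrep]
      exact (integrable_inv_mul_comp_div hE hk).integrable_convolution _ hi'
    · calc weightedDensity E (k + 1) z ≤ ∫ t, E t * M := by
            refine integral_mono ?_ (hE.mul_const M) fun t => ?_
            · exact hE.mul_bdd (c := M) (by fun_prop) (ae_of_all _ fun t => hbd _)
            · exact mul_le_mul_of_nonneg_left (hM' _) (hn t)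
        _ = M := by rw [integral_mul_const, h1, one_mul]

theorem ofReal_weightedDensity_succ (hn : ∀ x, 0 ≤ E x) (hc : Continuous E) (hM : ∀ x, E x ≤ M)
    (hE : Integrable E) (h1 : ∫ x, E x = 1) (k : ℕ) (z : ℝ) :
    ENNReal.ofReal (weightedDensity E (k + 1) z) =
      ∫⁻ t, ENNReal.ofReal (E t) * ENNReal.ofReal (weightedDensity E k (z - (k + 2) * t)) := by
  obtain ⟨hc', -, hM'⟩ := weightedDensity_regularity hn hc hM hE h1 k
  have hbd : ∀ z, ‖weightedDensity E k z‖ ≤ M := fun z => by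
    rw [Real.norm_of_nonneg (weightedDensity_nonneg hn k z)]; exact hM' z
  simp_rw [← ENNReal.ofReal_mul (hn _)]
  rw [← ofReal_integral_eq_lintegral_ofReal]
  · rfl
  · exact hE.mul_bdd (c := M) (by fun_prop) (ae_of_all _ fun t => hbd _)
  · exact ae_of_all _ fun t => mul_nonneg (hn t) (weightedDensity_nonneg hn k _)

theorem norm_fourier_weightedDensity (hn : ∀ x, 0 ≤ E x) (hc : Continuous E) (hM : ∀ x, E x ≤ M)
    (hE : Integrable E) (h1 : ∫ x, E x = 1) (k : ℕ) (ξ : ℝ) :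
    ‖𝓕 (fun z => (weightedDensity E k z : ℂ)) ξ‖ =
      ∏ j ∈ Finset.range (k + 1), ‖𝓕 (fun z => (E z : ℂ)) ((j + 1) * ξ)‖ := by
  induction k with
  | zero => simp [weightedDensity]
  | succ k ih =>
    rw [Finset.prod_range_succ, ← ih]
    have := fourier_integral_mul_comp_sub_mul hE
      (weightedDensity_regularity hn hc hM hE h1 k).2.1 (a := k + 2) (by positivity) ξ
    rw [mul_comm, ← norm_mul]
    push_cast
    rw [add_assoc, one_add_one_eq_two, ← this]
    rfl

end weightedDensity

theorem norm_le_integral_norm_fourier {f : ℝ → ℂ} (hc : Continuous f) (hf : Integrable f)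
    (hf' : Integrable (𝓕 f)) (z : ℝ) : ‖f z‖ ≤ ∫ ξ, ‖𝓕 f ξ‖ := by
  rw [← congrFun (hc.fourierInv_fourier_eq hf hf') z, Real.fourierInv_eq]
  refine (norm_integral_le_integral_norm _).trans (le_of_eq ?_)
  simp only [Circle.norm_smul]

theorem pow_three_div_three_le_sum_sq (K : ℕ) :
    (K : ℝ) ^ 3 / 3 ≤ ∑ j ∈ Finset.range K, ((j : ℝ) + 1) ^ 2 := by
  induction K with
  | zero => simp
  | succ K ih =>
    rw [Finset.sum_range_succ]
    push_cast
    have : (0 : ℝ) ≤ K := K.cast_nonneg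
    nlinarith

theorem exp_neg_mul_sqrt_le {κ : ℝ} (hκ : 0 < κ) {x : ℝ} (hx : 1 ≤ x) :
    Real.exp (-(κ * x ^ (1 / 2 : ℝ))) ≤ 6 / κ ^ 3 * x ^ (-(5 / 4) : ℝ) := by
  have hx0 : 0 < x := by linarith
  set y := κ * x ^ (1 / 2 : ℝ) with hy
  have hy0 : 0 < y := by positivity
  have h := Real.pow_div_factorial_le_exp y hy0.le 3
  have hy3 : y ^ 3 = κ ^ 3 * x ^ (3 / 2 : ℝ) := by
    rw [hy, mul_pow, ← Real.rpow_natCast (x ^ (1 / 2 : ℝ)), ← Real.rpow_mul hx0.le]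
    norm_num
  rw [Real.exp_neg]
  calc (Real.exp y)⁻¹ ≤ (y ^ 3 / (Nat.factorial 3 : ℝ))⁻¹ := by gcongr
    _ = 6 / κ ^ 3 * x ^ (-(3 / 2) : ℝ) := by
      rw [hy3, Real.rpow_neg hx0.le]
      simp [Nat.factorial]
      field_simp
    _ ≤ _ := by
      gcongr 6 / κ ^ 3 * ?_
      exact Real.rpow_le_rpow_of_exponent_le hx (by norm_num)

/-- The densities of the weighted sums decay faster than `1 / k`. -/
theorem exists_weightedDensity_le {E : ℝ → ℝ} {M : ℝ} (hn : ∀ x, 0 ≤ E x) (hc : Continuous E)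
    (hM : ∀ x, E x ≤ M) (hE : Integrable E) (h1 : ∫ x, E x = 1) (h0 : 0 < E 0) :
    ∃ A, 0 ≤ A ∧ ∀ (k : ℕ) (z : ℝ), weightedDensity E k z ≤ A * ((k : ℝ) + 1) ^ (-(5 / 4) : ℝ) := by
  obtain ⟨κ, hκ, hexp⟩ := norm_fourier_le_exp hE hc hn h0 h1
  set Φ : ℝ → ℝ := fun ξ => ‖𝓕 (fun x => (E x : ℂ)) ξ‖ with hΦ
  have hΦ0 : ∀ ξ, 0 ≤ Φ ξ := fun ξ => norm_nonneg _
  have hΦ2 : Integrable (fun ξ => Φ ξ ^ 2) := integrable_norm_fourier_sq hE hc (M := M)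
    fun x => by rw [abs_of_nonneg (hn x)]; exact hM x
  set S := ∫ ξ, Φ ξ ^ 2 with hS
  have hS0 : 0 ≤ S := integral_nonneg fun ξ => by positivity
  have hM0 : 0 ≤ M := (hn 0).trans (hM 0)
  have hscale : ∀ a : ℝ, 1 ≤ a →
      Integrable (fun ξ => Φ (a * ξ) ^ 2) ∧ ∫ ξ, Φ (a * ξ) ^ 2 ≤ S := by
    intro a ha
    refine ⟨hΦ2.comp_mul_left' (by positivity), ?_⟩
    rw [Measure.integral_comp_mul_left (fun ξ => Φ ξ ^ 2) a, smul_eq_mul, abs_of_pos (by positivity)]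
    exact mul_le_of_le_one_left hS0 (inv_le_one_of_one_le₀ ha)
  refine ⟨4 * M + 2 + 6 / (κ / 81) ^ 3 * S, by positivity, fun k z => ?_⟩
  obtain ⟨hwc, hwi, hwM⟩ := weightedDensity_regularity hn hc hM hE h1 k
  set s := ((k : ℝ) + 1) ^ (-(5 / 4) : ℝ) with hs
  have hs0 : 0 < s := by positivity
  have hrest : 0 ≤ (2 + 6 / (κ / 81) ^ 3 * S) * s := by positivity
  rcases lt_or_ge k 2 with hk | hk
  · have hk2 : (k : ℝ) + 1 ≤ 2 := by
      have : k ≤ 1 := by omega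
      have : (k : ℝ) ≤ 1 := by exact_mod_cast this
      linarith
    have h4 : 1 / 4 ≤ s := by
      calc (1 / 4 : ℝ) = 2 ^ (-2 : ℝ) := by
            rw [Real.rpow_neg (by norm_num)]; norm_num
        _ ≤ ((k : ℝ) + 1) ^ (-2 : ℝ) :=
            Real.rpow_le_rpow_of_nonpos (by positivity) hk2 (by norm_num)
        _ ≤ s := Real.rpow_le_rpow_of_exponent_le (by linarith [k.cast_nonneg (α := ℝ)])
            (by norm_num)
    have := hwM z
    nlinarith [mul_le_mul_of_nonneg_left h4 hM0]
  obtain ⟨K, rfl⟩ : ∃ K, k = K + 1 := ⟨k - 1, by omega⟩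
  have hK : 1 ≤ K := by omega
  have hKr : (1 : ℝ) ≤ K := by exact_mod_cast hK
  push_cast at hs
  rw [add_assoc, one_add_one_eq_two] at hs
  have hs1 : s * (K + 2) ≤ 1 := by
    calc s * (K + 2) = (K + 2 : ℝ) ^ (-(1 / 4) : ℝ) := by
          rw [hs]; nth_rw 2 [← Real.rpow_one ((K : ℝ) + 2)]
          rw [← Real.rpow_add (by positivity)]; norm_num
      _ ≤ 1 := Real.rpow_le_one_of_one_le_of_nonpos (by linarith) (by norm_num)
  have hprod : ∀ ξ, ‖𝓕 (fun z => (weightedDensity E (K + 1) z : ℂ)) ξ‖ =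
      (∏ j ∈ Finset.range K, Φ ((j + 1) * ξ)) * Φ ((K + 1) * ξ) * Φ ((K + 2) * ξ) := by
    intro ξ
    rw [norm_fourier_weightedDensity hn hc hM hE h1, Finset.prod_range_succ,
      Finset.prod_range_succ]
    push_cast
    rw [add_assoc (K : ℝ), one_add_one_eq_two]
  have hle1 : ∀ ξ, Φ ξ ≤ 1 := fun ξ => (hexp ξ).trans (by
    rw [Real.exp_le_one_iff]
    have : 0 ≤ min (ξ ^ 2) 1 := by positivity
    nlinarith)
  set δ := Real.exp (-(κ / 81 * ((K : ℝ) + 2) ^ (1 / 2 : ℝ))) with hδ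
  have hP : ∀ ξ, s ≤ |ξ| → ∏ j ∈ Finset.range K, Φ ((j + 1) * ξ) ≤ δ := by
    intro ξ hξ
    have hmin : ∀ j ∈ Finset.range K, ((j : ℝ) + 1) ^ 2 * s ^ 2 ≤ min ((((j : ℝ) + 1) * ξ) ^ 2) 1 := by
      intro j hj
      have hj' : (j : ℝ) + 1 ≤ K + 2 := by
        have : j < K := Finset.mem_range.1 hj
        have : (j : ℝ) < K := by exact_mod_cast this
        linarith
      refine le_min ?_ ?_
      · rw [mul_pow, ← sq_abs ξ]
        gcongr
      · rw [← mul_pow]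
        refine pow_le_one₀ (by positivity) ?_
        calc ((j : ℝ) + 1) * s ≤ (K + 2) * s := by gcongr
          _ ≤ 1 := by linarith
    calc ∏ j ∈ Finset.range K, Φ ((j + 1) * ξ)
        ≤ ∏ j ∈ Finset.range K, Real.exp (-κ * (((j : ℝ) + 1) ^ 2 * s ^ 2)) := by
          refine Finset.prod_le_prod (fun _ _ => hΦ0 _) fun j hj => (hexp _).trans ?_
          rw [Real.exp_le_exp, neg_mul, neg_mul, neg_le_neg_iff]
          exact mul_le_mul_of_nonneg_left (hmin j hj) hκ.le
      _ = Real.exp (-(κ * s ^ 2 * ∑ j ∈ Finset.range K, ((j : ℝ) + 1) ^ 2)) := by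
          rw [← Real.exp_sum, Finset.mul_sum, ← Finset.sum_neg_distrib]
          congr 1
          exact Finset.sum_congr rfl fun _ _ => by ring
      _ ≤ δ := by
          rw [hδ, Real.exp_le_exp, neg_le_neg_iff]
          have hs2 : s ^ 2 * (K + 2) ^ 3 = ((K : ℝ) + 2) ^ (1 / 2 : ℝ) := by
            rw [hs, ← Real.rpow_natCast, ← Real.rpow_natCast, ← Real.rpow_mul (by positivity),
              ← Real.rpow_add (by positivity)]
            norm_num
          rw [← hs2]
          have h3 : ((K : ℝ) + 2) ^ 3 / 27 ≤ K ^ 3 := by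
            have : ((K : ℝ) + 2) ^ 3 ≤ (3 * K) ^ 3 := by gcongr; linarith
            linarith
          have h4 := pow_three_div_three_le_sum_sq K
          calc κ / 81 * (s ^ 2 * (K + 2) ^ 3) = κ * s ^ 2 * ((K + 2) ^ 3 / 27 / 3) := by ring
            _ ≤ κ * s ^ 2 * ∑ j ∈ Finset.range K, ((j : ℝ) + 1) ^ 2 := by
              gcongr
              linarith
  set G : ℝ → ℝ := fun ξ => (Icc (-s) s).indicator (fun _ => (1 : ℝ)) ξ +
    δ * (Φ ((K + 1) * ξ) ^ 2 / 2 + Φ ((K + 2) * ξ) ^ 2 / 2) with hG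
  obtain ⟨hi1, hS1⟩ := hscale (K + 1) (by linarith)
  obtain ⟨hi2, hS2⟩ := hscale (K + 2) (by linarith)
  have hind : Integrable ((Icc (-s) s).indicator (fun _ => (1 : ℝ))) :=
    (integrable_indicator_iff measurableSet_Icc).2 (by simp [integrableOn_const_iff])
  have hi : Integrable fun ξ => δ * (Φ ((K + 1) * ξ) ^ 2 / 2 + Φ ((K + 2) * ξ) ^ 2 / 2) :=
    ((hi1.div_const 2).add (hi2.div_const 2)).const_mul δ
  have hGi : Integrable G := hind.add hi
  have hGint : ∫ ξ, G ξ ≤ 2 * s + δ * S := by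
    simp only [hG]
    rw [integral_add hind hi,
      integral_const_mul, integral_add (hi1.div_const 2) (hi2.div_const 2), integral_div,
      integral_div, integral_indicator measurableSet_Icc]
    have : ∫ ξ in Icc (-s) s, (1 : ℝ) = 2 * s := by
      simp [Measure.real, two_mul, hs0.le]
    rw [this]
    gcongr
    linarith
  have hFG : ∀ ξ, ‖𝓕 (fun z => (weightedDensity E (K + 1) z : ℂ)) ξ‖ ≤ G ξ := by
    intro ξ
    rw [hprod]
    simp only [hG]
    have hP0 : 0 ≤ ∏ j ∈ Finset.range K, Φ ((j + 1) * ξ) := Finset.prod_nonneg fun _ _ => hΦ0 _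
    have hδ0 : 0 ≤ δ := Real.exp_nonneg _
    by_cases hξ : ξ ∈ Icc (-s) s
    · rw [indicator_of_mem hξ]
      have : (∏ j ∈ Finset.range K, Φ ((j + 1) * ξ)) * Φ ((K + 1) * ξ) * Φ ((K + 2) * ξ) ≤ 1 := by
        refine mul_le_one₀ (mul_le_one₀ ?_ (hΦ0 _) (hle1 _)) (hΦ0 _) (hle1 _)
        exact Finset.prod_le_one (fun _ _ => hΦ0 _) fun _ _ => hle1 _
      have : 0 ≤ δ * (Φ ((K + 1) * ξ) ^ 2 / 2 + Φ ((K + 2) * ξ) ^ 2 / 2) := by positivity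
      linarith
    · rw [indicator_of_notMem hξ, zero_add, mul_assoc]
      have hξ' : s ≤ |ξ| := by
        by_contra! h
        exact hξ ⟨(abs_lt.1 h).1.le, (abs_lt.1 h).2.le⟩
      refine mul_le_mul (hP ξ hξ') ?_ (mul_nonneg (hΦ0 _) (hΦ0 _)) hδ0
      nlinarith [sq_nonneg (Φ ((K + 1) * ξ) - Φ ((K + 2) * ξ))]
  have hwi' : Integrable (fun z => (weightedDensity E (K + 1) z : ℂ)) := hwi.ofReal
  have hFi : Integrable (𝓕 (fun z => (weightedDensity E (K + 1) z : ℂ))) :=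
    hGi.mono' (continuous_fourier_of_integrable hwi').aestronglyMeasurable (ae_of_all _ hFG)
  have hδs : δ ≤ 6 / (κ / 81) ^ 3 * s := by
    rw [hδ, hs]
    exact exp_neg_mul_sqrt_le (by positivity) (by linarith)
  calc weightedDensity E (K + 1) z ≤ ‖(weightedDensity E (K + 1) z : ℂ)‖ := by
        rw [Complex.norm_real]; exact le_abs_self _
    _ ≤ ∫ ξ, ‖𝓕 (fun z => (weightedDensity E (K + 1) z : ℂ)) ξ‖ :=
        norm_le_integral_norm_fourier (f := fun z => (weightedDensity E (K + 1) z : ℂ))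
          (Complex.continuous_ofReal.comp hwc) hwi' hFi z
    _ ≤ ∫ ξ, G ξ := integral_mono hFi.norm hGi hFG
    _ ≤ 2 * s + δ * S := hGint
    _ ≤ 2 * s + 6 / (κ / 81) ^ 3 * s * S := by gcongr
    _ ≤ _ := by nlinarith [mul_nonneg hM0 hs0.le]

section Moments

variable {E : ℝ → ℝ} {M : ℝ}

theorem lintegral_weightedDensity_succ_mul (hn : ∀ x, 0 ≤ E x) (hc : Continuous E)
    (hM : ∀ x, E x ≤ M) (hE : Integrable E) (h1 : ∫ x, E x = 1) (k : ℕ)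
    {g : ℝ → ℝ≥0∞} (hg : Measurable g) :
    ∫⁻ z, ENNReal.ofReal (weightedDensity E (k + 1) z) * g z =
      ∫⁻ t, ENNReal.ofReal (E t) *
        ∫⁻ z, ENNReal.ofReal (weightedDensity E k z) * g (z + (k + 2) * t) := by
  have hwc := (weightedDensity_regularity hn hc hM hE h1 k).1
  simp_rw [ofReal_weightedDensity_succ hn hc hM hE h1 k]
  calc _ = ∫⁻ z, ∫⁻ t, ENNReal.ofReal (E t) *
        (ENNReal.ofReal (weightedDensity E k (z - (k + 2) * t)) * g z) := by
        congr with z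
        rw [← lintegral_mul_const _ (by fun_prop)]
        simp only [mul_assoc]
    _ = ∫⁻ t, ∫⁻ z, ENNReal.ofReal (E t) *
        (ENNReal.ofReal (weightedDensity E k (z - (k + 2) * t)) * g z) := by
        refine lintegral_lintegral_swap (Measurable.aemeasurable ?_)
        fun_prop
    _ = _ := by
        congr with t
        rw [lintegral_const_mul _ (by fun_prop)]
        congr 1
        rw [← lintegral_add_right_eq_self _ ((k + 2) * t)]
        simp

theorem lintegral_weightedDensity (hn : ∀ x, 0 ≤ E x) (hc : Continuous E)
    (hM : ∀ x, E x ≤ M) (hE : Integrable E) (h1 : ∫ x, E x = 1) (k : ℕ) :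
    ∫⁻ z, ENNReal.ofReal (weightedDensity E k z) = 1 := by
  have hE1 : ∫⁻ t, ENNReal.ofReal (E t) = 1 := by
    rw [← ofReal_integral_eq_lintegral_ofReal hE (ae_of_all _ hn), h1, ENNReal.ofReal_one]
  induction k with
  | zero => exact hE1
  | succ k ih =>
    have := lintegral_weightedDensity_succ_mul hn hc hM hE h1 k (g := 1) measurable_one
    simpa [ih, hE1] using this

theorem lintegral_weightedDensity_mul_abs_le (hn : ∀ x, 0 ≤ E x) (hc : Continuous E)
    (hM : ∀ x, E x ≤ M) (hE : Integrable E) (h1 : ∫ x, E x = 1) (k : ℕ) :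
    ∫⁻ z, ENNReal.ofReal (weightedDensity E k z) * ENNReal.ofReal |z| ≤
      (k + 1) ^ 2 * ∫⁻ t, ENNReal.ofReal (E t) * ENNReal.ofReal |t| := by
  have hE1 : ∫⁻ t, ENNReal.ofReal (E t) = 1 := by
    rw [← ofReal_integral_eq_lintegral_ofReal hE (ae_of_all _ hn), h1, ENNReal.ofReal_one]
  set m := ∫⁻ t, ENNReal.ofReal (E t) * ENNReal.ofReal |t| with hm
  induction k with
  | zero => simp [weightedDensity, hm]
  | succ k ih =>
    have hwc := (weightedDensity_regularity hn hc hM hE h1 k).1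
    rw [lintegral_weightedDensity_succ_mul hn hc hM hE h1 k (by fun_prop)]
    have hinner : ∀ t : ℝ, ∫⁻ z, ENNReal.ofReal (weightedDensity E k z) *
        ENNReal.ofReal |z + (k + 2) * t| ≤ (k + 1) ^ 2 * m + (k + 2) * ENNReal.ofReal |t| := by
      intro t
      calc _ ≤ ∫⁻ z, (ENNReal.ofReal (weightedDensity E k z) * ENNReal.ofReal |z| +
            ENNReal.ofReal (weightedDensity E k z) * ((k + 2) * ENNReal.ofReal |t|)) := by
            refine lintegral_mono fun z => ?_
            rw [← mul_add]
            gcongr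
            have h2 : ((k : ℝ≥0∞) + 2) = ENNReal.ofReal (k + 2) := by
              rw [ENNReal.ofReal_add (by positivity) (by norm_num)]; simp
            rw [h2, ← ENNReal.ofReal_mul (by positivity), ← ENNReal.ofReal_add (abs_nonneg _)
              (by positivity)]
            refine ENNReal.ofReal_le_ofReal ((abs_add_le _ _).trans ?_)
            rw [abs_mul, abs_of_pos (by positivity : (0 : ℝ) < k + 2)]
        _ ≤ _ := by
            rw [lintegral_add_left (by fun_prop), lintegral_mul_const _ (by fun_prop),
              lintegral_weightedDensity hn hc hM hE h1 k, one_mul]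
            gcongr
    calc _ ≤ ∫⁻ t, (ENNReal.ofReal (E t) * ((k + 1) ^ 2 * m) +
          (k + 2) * (ENNReal.ofReal (E t) * ENNReal.ofReal |t|)) := by
          refine lintegral_mono fun t => ?_
          refine (mul_le_mul_right (hinner t) _).trans (le_of_eq ?_)
          ring
      _ = ((k + 1) ^ 2 + (k + 2)) * m := by
          rw [lintegral_add_left (by fun_prop), lintegral_mul_const _ (by fun_prop),
            lintegral_const_mul _ (by fun_prop), hE1, ← hm]
          ring
      _ ≤ _ := by
          gcongr
          norm_cast
          nlinarith

end Moments

section Chain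

/-- Joint weight of the chain `a, b, c_1, …, c_k, y, z` integrated over `c_1, …, c_k`, where each
consecutive triple is weighted by `e` of its discrete Laplacian. -/
def chain (e : ℝ → ℝ≥0∞) : ℕ → ℝ → ℝ → ℝ → ℝ → ℝ≥0∞
  | 0, a, b, y, z => e (y + a - 2 * b) * e (z + b - 2 * y)
  | k + 1, a, b, y, z => ∫⁻ c, e (c + a - 2 * b) * chain e k b c y z

variable {e : ℝ → ℝ≥0∞}

theorem measurable_chain_tuple (he : Measurable e) (k : ℕ) :
    Measurable fun p : ℝ × ℝ × ℝ × ℝ => chain e k p.1 p.2.1 p.2.2.1 p.2.2.2 := by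
  induction k with
  | zero => simp only [chain]; fun_prop
  | succ k ih =>
    simp only [chain]
    refine Measurable.lintegral_prod_right'
      (f := fun q : (ℝ × ℝ × ℝ × ℝ) × ℝ => e (q.2 + q.1.1 - 2 * q.1.2.1) *
        chain e k q.1.2.1 q.2 q.1.2.2.1 q.1.2.2.2) ?_
    refine Measurable.mul (by fun_prop) ?_
    exact ih.comp (g := fun p : ℝ × ℝ × ℝ × ℝ => chain e k p.1 p.2.1 p.2.2.1 p.2.2.2)
      (f := fun q : (ℝ × ℝ × ℝ × ℝ) × ℝ => (q.1.2.1, q.2, q.1.2.2.1, q.1.2.2.2)) (by fun_prop)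

@[fun_prop]
theorem Measurable.chain {α : Type*} [MeasurableSpace α] (he : Measurable e) (k : ℕ)
    {a b y z : α → ℝ} (ha : Measurable a) (hb : Measurable b) (hy : Measurable y)
    (hz : Measurable z) : Measurable fun i => chain e k (a i) (b i) (y i) (z i) :=
  (measurable_chain_tuple he k).comp (ha.prodMk (hb.prodMk (hy.prodMk hz)))

theorem chain_succ_last (he : Measurable e) (k : ℕ) (a b y z : ℝ) :
    chain e (k + 1) a b y z = ∫⁻ c, chain e k a b c y * e (z + c - 2 * y) := by
  induction k generalizing a b with
  | zero => simp only [chain, mul_assoc]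
  | succ k ih =>
    rw [chain]
    simp_rw [ih]
    calc _ = ∫⁻ d, ∫⁻ c, e (d + a - 2 * b) * chain e k b d c y * e (z + c - 2 * y) := by
          congr with d
          rw [← lintegral_const_mul _ (by fun_prop)]
          simp only [mul_assoc]
      _ = ∫⁻ c, ∫⁻ d, e (d + a - 2 * b) * chain e k b d c y * e (z + c - 2 * y) := by
          refine lintegral_lintegral_swap (Measurable.aemeasurable ?_)
          fun_prop
      _ = _ := by
          congr with c
          rw [lintegral_mul_const _ (by fun_prop)]
          rfl

/-- Integrand of `chain`. -/
def chainProd (e : ℝ → ℝ≥0∞) : (k : ℕ) → ℝ → ℝ → ℝ → ℝ → (Fin k → ℝ) → ℝ≥0∞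
  | 0, a, b, y, z, _ => e (y + a - 2 * b) * e (z + b - 2 * y)
  | k + 1, a, b, y, z, w => e (w 0 + a - 2 * b) * chainProd e k b (w 0) y z (Fin.tail w)

theorem measurable_chainProd (he : Measurable e) (k : ℕ) (y z : ℝ) :
    Measurable fun p : ℝ × ℝ × (Fin k → ℝ) => chainProd e k p.1 p.2.1 y z p.2.2 := by
  induction k with
  | zero => simp only [chainProd]; fun_prop
  | succ k ih =>
    simp only [chainProd]
    refine Measurable.mul (by fun_prop) ?_
    refine ih.comp (g := fun p : ℝ × ℝ × (Fin k → ℝ) => chainProd e k p.1 p.2.1 y z p.2.2)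
      (f := fun q : ℝ × ℝ × (Fin (k + 1) → ℝ) => (q.2.1, q.2.2 0, Fin.tail q.2.2)) ?_
    refine Measurable.prodMk (by fun_prop) (Measurable.prodMk (by fun_prop) ?_)
    exact measurable_pi_lambda _ fun i => (measurable_pi_apply i.succ).comp (by fun_prop)

theorem lintegral_chainProd (he : Measurable e) (k : ℕ) (a b y z : ℝ) :
    ∫⁻ w, chainProd e k a b y z w = chain e k a b y z := by
  induction k generalizing a b with
  | zero => simp [chainProd, chain, lintegral_unique, volume_pi]
  | succ k ih =>
    have hmp := volume_preserving_piFinSuccAbove (fun _ : Fin (k + 1) => ℝ) 0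
    have hmeas : Measurable fun p : ℝ × (Fin k → ℝ) =>
        e (p.1 + a - 2 * b) * chainProd e k b p.1 y z p.2 := by
      refine Measurable.mul (by fun_prop) ?_
      exact (measurable_chainProd he k y z).comp (f := fun p : ℝ × (Fin k → ℝ) => (b, p.1, p.2))
        (by fun_prop)
    calc _ = ∫⁻ p : ℝ × (Fin k → ℝ), e (p.1 + a - 2 * b) * chainProd e k b p.1 y z p.2 := by
          rw [← hmp.lintegral_comp hmeas]
          rfl
      _ = ∫⁻ c, ∫⁻ w : Fin k → ℝ, e (c + a - 2 * b) * chainProd e k b c y z w :=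
          lintegral_prod _ hmeas.aemeasurable
      _ = _ := by
          rw [chain]
          congr with c
          rw [lintegral_const_mul, ih]
          exact (measurable_chainProd he k y z).comp (f := fun w : Fin k → ℝ => (b, c, w))
            (by fun_prop)

theorem prod_laplacian_eq_chainProd (k : ℕ) (U : ℕ → ℝ) (w : Fin k → ℝ)
    (hw : ∀ i : Fin k, U (i + 2) = w i) :
    ∏ m ∈ Finset.range (k + 2), e (U (m + 2) + U m - 2 * U (m + 1)) =
      chainProd e k (U 0) (U 1) (U (k + 2)) (U (k + 3)) w := by
  induction k generalizing U with
  | zero => simp [Finset.prod_range_succ, chainProd]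
  | succ k ih =>
    rw [Finset.prod_range_succ', mul_comm, chainProd]
    have h0 : w 0 = U 2 := (hw 0).symm
    rw [h0]
    congr 1
    exact ih (fun j => U (j + 1)) (Fin.tail w) fun i => hw i.succ

end Chain

theorem ofReal_integral_le_lintegral {α : Type*} [MeasurableSpace α] (μ : Measure α) {f : α → ℝ}
    (hf : ∀ x, 0 ≤ f x) : ENNReal.ofReal (∫ x, f x ∂μ) ≤ ∫⁻ x, ENNReal.ofReal (f x) ∂μ := by
  by_cases h : Integrable f μ
  · rw [ofReal_integral_eq_lintegral_ofReal h (ae_of_all _ hf)]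
  · simp [integral_undef h]

theorem fpin_nonneg {E : ℝ → ℝ} (hn : ∀ x, 0 ≤ E x) (x y : ℝ) (n : ℕ) : 0 ≤ fpin E x y n := by
  unfold fpin
  split_ifs
  · exact hn x
  · exact le_rfl
  · exact le_rfl
  · exact integral_nonneg fun w => Finset.prod_nonneg fun _ _ => hn _

theorem ofReal_fpin_le_chain {E : ℝ → ℝ} (hn : ∀ x, 0 ≤ E x) (hE : Measurable E) (x y : ℝ) (k : ℕ) :
    ENNReal.ofReal (fpin E x y (k + 2)) ≤ chain (fun t => ENNReal.ofReal (E t)) k x 0 y 0 := by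
  unfold fpin
  rw [if_neg (by omega)]
  split_ifs with hy
  · simp
  refine (ofReal_integral_le_lintegral _ fun w => Finset.prod_nonneg fun _ _ => hn _).trans ?_
  rw [← lintegral_chainProd (by fun_prop)]
  refine le_of_eq (lintegral_congr fun w => ?_)
  rw [ENNReal.ofReal_prod_of_nonneg fun _ _ => hn _]
  set U : ℕ → ℝ := fun j => fExt x y (k + 2) w ((j : ℤ) - 1) with hU
  have hU0 : U 0 = x := by simp [hU, fExt]
  have hU1 : U 1 = 0 := by simp [hU, fExt]
  have hUy : U (k + 2) = y := by
    simp only [hU, fExt]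
    push_cast
    rw [dif_neg (by omega), dif_neg (by omega), dif_neg (by omega)]
  have hUz : U (k + 3) = 0 := by
    simp only [hU, fExt]
    push_cast
    rw [dif_neg (by omega), dif_neg (by omega), dif_neg (by omega), if_neg (by omega)]
  have hUw : ∀ i : Fin k, U (i + 2) = w i := by
    intro i
    have := i.2
    simp only [hU, fExt]
    push_cast
    rw [dif_neg (by omega), dif_neg (by omega), dif_pos (by omega)]
    congr 1
    ext
    simp
    omega
  have key := prod_laplacian_eq_chainProd (e := fun t => ENNReal.ofReal (E t)) k U w hUw
  rw [hU0, hU1, hUy, hUz] at key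
  refine Eq.trans ?_ key
  refine Finset.prod_bij' (fun m _ => m.toNat) (fun m _ => (m : ℤ)) ?_ ?_ ?_ ?_ ?_
  · intro m hm
    simp only [Finset.mem_Icc, Finset.mem_range] at hm ⊢
    push_cast at hm
    omega
  · intro m hm
    simp only [Finset.mem_Icc, Finset.mem_range] at hm ⊢
    push_cast
    omega
  · intro m hm
    simp only [Finset.mem_Icc] at hm
    omega
  · intro m _
    simp
  · intro m hm
    simp only [Finset.mem_Icc] at hm
    obtain ⟨j, rfl⟩ := Int.eq_ofNat_of_zero_le hm.1
    simp only [hU, Int.toNat_natCast]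
    push_cast
    congr 4 <;> ring_nf

section SubEigenfunction

variable {E : ℝ → ℝ} {M : ℝ}

/-- The density at `0` of the end point of the integrated walk after `k + 1` steps, started from
the heights `a`, `b`, satisfies the one step Markov recursion. -/
theorem ofReal_weightedDensity_succ_eq_lintegral (hn : ∀ x, 0 ≤ E x) (hc : Continuous E)
    (hM : ∀ x, E x ≤ M) (hE : Integrable E) (h1 : ∫ x, E x = 1) (k : ℕ) (a b : ℝ) :
    ENNReal.ofReal (weightedDensity E (k + 1) ((k + 2) * (a - b) - b)) =
      ∫⁻ c, ENNReal.ofReal (E (c + a - 2 * b)) *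
        ENNReal.ofReal (weightedDensity E k ((k + 1) * (b - c) - c)) := by
  rw [ofReal_weightedDensity_succ hn hc hM hE h1 k,
    ← lintegral_add_right_eq_self _ (a - 2 * b)]
  refine lintegral_congr fun c => ?_
  congr 3 <;> ring

theorem lintegral_chain_endpoint (hn : ∀ x, 0 ≤ E x) (hc : Continuous E)
    (hM : ∀ x, E x ≤ M) (hE : Integrable E) (h1 : ∫ x, E x = 1) (k : ℕ) (a b : ℝ) :
    ∫⁻ y, chain (fun t => ENNReal.ofReal (E t)) k a b y 0 =
      ENNReal.ofReal (weightedDensity E (k + 1) ((k + 2) * (a - b) - b)) := by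
  have he : Measurable fun t => ENNReal.ofReal (E t) := by fun_prop
  induction k generalizing a b with
  | zero =>
    rw [ofReal_weightedDensity_succ_eq_lintegral hn hc hM hE h1]
    refine lintegral_congr fun c => ?_
    simp only [chain, weightedDensity]
    congr 3
    push_cast
    ring
  | succ k ih =>
    rw [ofReal_weightedDensity_succ_eq_lintegral hn hc hM hE h1]
    simp only [chain]
    rw [lintegral_lintegral_swap (Measurable.aemeasurable ?_)]
    · refine lintegral_congr fun c => ?_
      rw [lintegral_const_mul _ (Measurable.chain he k (by fun_prop) (by fun_prop) (by fun_prop)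
        (by fun_prop)), ih]
      push_cast
      ring_nf
    · refine Measurable.mul (by fun_prop) (Measurable.chain he k (by fun_prop) (by fun_prop)
        (by fun_prop) (by fun_prop))

theorem lintegral_chain_startpoint (hn : ∀ x, 0 ≤ E x) (hc : Continuous E)
    (hM : ∀ x, E x ≤ M) (hE : Integrable E) (h1 : ∫ x, E x = 1) (k : ℕ) (y z : ℝ) :
    ∫⁻ x, chain (fun t => ENNReal.ofReal (E t)) k x 0 y z =
      ENNReal.ofReal (weightedDensity E k ((k + 1) * (z - y) - y)) := by
  have he : Measurable fun t => ENNReal.ofReal (E t) := by fun_prop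
  have hE1 : ∫⁻ t, ENNReal.ofReal (E t) = 1 := by
    rw [← ofReal_integral_eq_lintegral_ofReal hE (ae_of_all _ hn), h1, ENNReal.ofReal_one]
  induction k generalizing y z with
  | zero =>
    simp only [chain, weightedDensity]
    rw [lintegral_mul_const _ (by fun_prop)]
    have : ∫⁻ x, ENNReal.ofReal (E (y + x - 2 * 0)) = 1 := by
      simp only [mul_zero, sub_zero]
      rw [lintegral_add_left_eq_self (fun x => ENNReal.ofReal (E x)) y, hE1]
    rw [this, one_mul]
    congr 2
    push_cast
    ring
  | succ k ih =>
    push_cast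
    rw [add_assoc (k : ℝ) 1 1, one_add_one_eq_two,
      ofReal_weightedDensity_succ_eq_lintegral hn hc hM hE h1]
    simp_rw [chain_succ_last he]
    rw [lintegral_lintegral_swap (Measurable.aemeasurable ?_)]
    · refine lintegral_congr fun c => ?_
      rw [lintegral_mul_const _ (Measurable.chain he k (by fun_prop) (by fun_prop) (by fun_prop)
        (by fun_prop)), ih, mul_comm, add_comm z c]
    · refine Measurable.mul (Measurable.chain he k (by fun_prop) (by fun_prop)
        (by fun_prop) (by fun_prop)) (by fun_prop)

theorem log_max_sq_nonneg (x : ℝ) : 0 ≤ Real.log (max (x ^ 2) 1) :=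
  Real.log_nonneg (le_max_right _ _)

theorem log_max_sq_le (x : ℝ) : Real.log (max (x ^ 2) 1) ≤ x ^ 2 := by
  rcases max_cases (x ^ 2) 1 with ⟨h, -⟩ | ⟨h, -⟩
  · rw [h]; exact Real.log_le_self (sq_nonneg x)
  · rw [h, Real.log_one]; positivity

/-- The squared logarithm grows more slowly than `|x| ^ (1 / 16)`, split at scale `s`. -/
theorem log_max_sq_sq_le (x : ℝ) {s : ℝ} (hs : 1 ≤ s) :
    Real.log (max (x ^ 2) 1) ^ 2 ≤
      4096 * (s ^ (1 / 16 : ℝ) + s ^ (-(15 / 16) : ℝ) * |x|) := by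
  have hs0 : 0 < s := by linarith
  set r := max |x| 1 with hr
  have hr1 : 1 ≤ r := le_max_right _ _
  have hr0 : 0 < r := by linarith
  have hmax : max (x ^ 2) 1 = r ^ 2 := by
    rw [hr]
    rcases le_total |x| 1 with h | h
    · rw [max_eq_right h, one_pow, max_eq_right]
      rw [← sq_abs]; nlinarith [abs_nonneg x]
    · rw [max_eq_left h, sq_abs, max_eq_left]
      rw [← sq_abs]; nlinarith [abs_nonneg x]
  have hlog : Real.log r ≤ 32 * r ^ (1 / 32 : ℝ) := by
    have := Real.log_le_rpow_div hr0.le (ε := 1 / 32) (by norm_num)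
    linarith
  have hsq : Real.log (max (x ^ 2) 1) ^ 2 ≤ 4096 * r ^ (1 / 16 : ℝ) := by
    have h2 : r ^ (1 / 16 : ℝ) = (r ^ (1 / 32 : ℝ)) ^ 2 := by
      rw [← Real.rpow_natCast, ← Real.rpow_mul hr0.le]; norm_num
    rw [hmax, Real.log_pow, h2]
    have h0 := Real.log_nonneg hr1
    push_cast
    nlinarith [Real.rpow_nonneg hr0.le (1 / 32 : ℝ)]
  refine hsq.trans (mul_le_mul_of_nonneg_left ?_ (by norm_num))
  have hpos : 0 ≤ s ^ (-(15 / 16) : ℝ) * |x| := by positivity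
  have hpos' : 0 ≤ s ^ (1 / 16 : ℝ) := by positivity
  rcases le_total r s with h | h
  · have := Real.rpow_le_rpow hr0.le h (by norm_num : (0 : ℝ) ≤ 1 / 16)
    linarith
  · rcases le_total |x| 1 with hx | hx
    · have hr' : r = 1 := max_eq_right hx
      rw [hr', Real.one_rpow]
      have := Real.one_le_rpow hs (by norm_num : (0 : ℝ) ≤ 1 / 16)
      linarith
    · have hr' : r = |x| := max_eq_left hx
      have : r ^ (1 / 16 : ℝ) ≤ s ^ (-(15 / 16) : ℝ) * |x| := by
        rw [← hr']
        calc r ^ (1 / 16 : ℝ) = r ^ (-(15 / 16) : ℝ) * r := by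
              rw [← Real.rpow_add_one hr0.ne']; norm_num
          _ ≤ _ := mul_le_mul_of_nonneg_right
              (Real.rpow_le_rpow_of_nonpos hs0 h (by norm_num)) hr0.le
      linarith

theorem lintegral_comp_mul_left_of_pos (g : ℝ → ℝ≥0∞) {s : ℝ} (hs : 0 < s) :
    ∫⁻ x, g (s * x) = ENNReal.ofReal s⁻¹ * ∫⁻ z, g z := by
  have hemb : MeasurableEmbedding fun x : ℝ => s * x :=
    (Homeomorph.mulLeft₀ s hs.ne').measurableEmbedding
  rw [← hemb.lintegral_map g, Real.map_volume_mul_left hs.ne', lintegral_smul_measure,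
    abs_of_pos (inv_pos.2 hs), smul_eq_mul]

theorem exists_lintegral_weightedDensity_mul_log_sq_le (hn : ∀ x, 0 ≤ E x) (hc : Continuous E)
    (hM : ∀ x, E x ≤ M) (hE : Integrable E) (h1 : ∫ x, E x = 1)
    (hmom : Integrable fun x => x * E x) :
    ∃ B : ℝ, 0 ≤ B ∧ ∀ k : ℕ,
      ∫⁻ x, ENNReal.ofReal (weightedDensity E (k + 1) ((k + 2) * x)) *
        ENNReal.ofReal (Real.log (max (x ^ 2) 1) ^ 2) ≤
      ENNReal.ofReal (B * ((k : ℝ) + 2) ^ (-(15 / 16) : ℝ)) := by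
  set m : ℝ := ∫ t, E t * |t| with hm
  have hm0 : 0 ≤ m := integral_nonneg fun t => mul_nonneg (hn t) (abs_nonneg t)
  have hEabs : Integrable fun t => E t * |t| := by
    refine hmom.norm.congr (ae_of_all _ fun t => ?_)
    simp only [norm_mul, Real.norm_eq_abs, abs_of_nonneg (hn t), mul_comm]
  have hmm : ∫⁻ t, ENNReal.ofReal (E t) * ENNReal.ofReal |t| = ENNReal.ofReal m := by
    rw [hm, ofReal_integral_eq_lintegral_ofReal hEabs
      (ae_of_all _ fun t => mul_nonneg (hn t) (abs_nonneg t))]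
    simp_rw [ENNReal.ofReal_mul (hn _)]
  refine ⟨4096 * (1 + m), by positivity, fun k => ?_⟩
  set s : ℝ := (k : ℝ) + 2 with hs
  have hs1 : 1 ≤ s := by rw [hs]; linarith [Nat.cast_nonneg (α := ℝ) k]
  have hs0 : 0 < s := by linarith
  have hwm : Measurable fun z => ENNReal.ofReal (weightedDensity E (k + 1) z) :=
    (weightedDensity_regularity hn hc hM hE h1 (k + 1)).1.measurable.ennreal_ofReal
  have hpt : ∀ x, ENNReal.ofReal (Real.log (max (x ^ 2) 1) ^ 2) ≤
      ENNReal.ofReal (4096 * s ^ (1 / 16 : ℝ)) +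
        ENNReal.ofReal (4096 * s ^ (-(31 / 16) : ℝ)) * ENNReal.ofReal |s * x| := fun x => by
    rw [← ENNReal.ofReal_mul (by positivity), ← ENNReal.ofReal_add (by positivity) (by positivity)]
    refine ENNReal.ofReal_le_ofReal ((log_max_sq_sq_le x hs1).trans (le_of_eq ?_))
    have : s ^ (-(15 / 16) : ℝ) = s ^ (-(31 / 16) : ℝ) * s := by
      rw [← Real.rpow_add_one hs0.ne']; norm_num
    rw [abs_mul, abs_of_pos hs0, this]
    ring
  calc _ ≤ ∫⁻ x, (fun z => ENNReal.ofReal (weightedDensity E (k + 1) z) *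
        (ENNReal.ofReal (4096 * s ^ (1 / 16 : ℝ)) +
        ENNReal.ofReal (4096 * s ^ (-(31 / 16) : ℝ)) * ENNReal.ofReal |z|)) (s * x) :=
        lintegral_mono fun x => mul_le_mul_right (hpt x) _
    _ = ENNReal.ofReal s⁻¹ * (ENNReal.ofReal (4096 * s ^ (1 / 16 : ℝ)) +
        ENNReal.ofReal (4096 * s ^ (-(31 / 16) : ℝ)) *
          ∫⁻ z, ENNReal.ofReal (weightedDensity E (k + 1) z) * ENNReal.ofReal |z|) := by
        rw [lintegral_comp_mul_left_of_pos (fun z => ENNReal.ofReal (weightedDensity E (k + 1) z) *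
          (ENNReal.ofReal (4096 * s ^ (1 / 16 : ℝ)) +
          ENNReal.ofReal (4096 * s ^ (-(31 / 16) : ℝ)) * ENNReal.ofReal |z|)) hs0]
        congr 1
        simp_rw [mul_add]
        rw [lintegral_add_left (by fun_prop), lintegral_mul_const _ hwm,
          lintegral_weightedDensity hn hc hM hE h1, one_mul,
          ← lintegral_const_mul _ (by fun_prop)]
        congr 1
        refine lintegral_congr fun z => ?_
        ring
    _ ≤ ENNReal.ofReal s⁻¹ * (ENNReal.ofReal (4096 * s ^ (1 / 16 : ℝ)) +
        ENNReal.ofReal (4096 * s ^ (-(31 / 16) : ℝ)) * ENNReal.ofReal (s ^ 2 * m)) := by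
        gcongr
        refine (lintegral_weightedDensity_mul_abs_le hn hc hM hE h1 (k + 1)).trans (le_of_eq ?_)
        rw [hmm, ENNReal.ofReal_mul (by positivity), ENNReal.ofReal_pow hs0.le, hs,
          ENNReal.ofReal_add (by positivity) (by norm_num)]
        push_cast
        rw [add_assoc, one_add_one_eq_two]
        simp
    _ = _ := by
        rw [← ENNReal.ofReal_mul (by positivity), ← ENNReal.ofReal_add (by positivity)
          (by positivity), ← ENNReal.ofReal_mul (by positivity)]
        congr 1
        have h16 : s ^ (1 / 16 : ℝ) = s ^ (-(15 / 16) : ℝ) * s := by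
          rw [← Real.rpow_add_one hs0.ne']; norm_num
        have h15 : s ^ (-(15 / 16) : ℝ) = s ^ (-(31 / 16) : ℝ) * s := by
          rw [← Real.rpow_add_one hs0.ne']; norm_num
        rw [h16, h15]
        field_simp

/-- A weighted Schur test for the kernel `chain`, with weight `l` in Young's inequality. -/
theorem lintegral_chain_mul_le (hn : ∀ x, 0 ≤ E x) (hc : Continuous E)
    (hM : ∀ x, E x ≤ M) (hE : Integrable E) (h1 : ∫ x, E x = 1) (k : ℕ) {f v : ℝ → ℝ}
    (hf : Measurable f) (hv : Measurable v) {D l : ℝ} (hl : 0 < l)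
    (hD : ∀ z, weightedDensity E k z ≤ D) (hv0 : ∀ y, 0 ≤ v y) (hf0 : ∀ y, 0 ≤ f y) :
    ∫⁻ x, (∫⁻ y, chain (fun t => ENNReal.ofReal (E t)) k x 0 y 0 * ENNReal.ofReal (v y)) *
        ENNReal.ofReal (f x) ≤
      ENNReal.ofReal l * (∫⁻ x, ENNReal.ofReal (weightedDensity E (k + 1) ((k + 2) * x)) *
        ENNReal.ofReal (f x ^ 2)) +
      ENNReal.ofReal (l⁻¹ * D) * ∫⁻ y, ENNReal.ofReal (v y ^ 2) := by
  have he : Measurable fun t => ENNReal.ofReal (E t) := by fun_prop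
  have hwm : Measurable fun z => ENNReal.ofReal (weightedDensity E (k + 1) z) :=
    (weightedDensity_regularity hn hc hM hE h1 (k + 1)).1.measurable.ennreal_ofReal
  have hch : Measurable fun p : ℝ × ℝ =>
      chain (fun t => ENNReal.ofReal (E t)) k p.1 0 p.2 0 :=
    Measurable.chain he k (by fun_prop) (by fun_prop) (by fun_prop) (by fun_prop)
  have hchx : ∀ x, Measurable fun y => chain (fun t => ENNReal.ofReal (E t)) k x 0 y 0 :=
    fun x => Measurable.chain he k (by fun_prop) (by fun_prop) (by fun_prop) (by fun_prop)
  have hchy : ∀ y, Measurable fun x => chain (fun t => ENNReal.ofReal (E t)) k x 0 y 0 :=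
    fun x => Measurable.chain he k (by fun_prop) (by fun_prop) (by fun_prop) (by fun_prop)
  have young : ∀ x y, ENNReal.ofReal (v y) * ENNReal.ofReal (f x) ≤
      ENNReal.ofReal l * ENNReal.ofReal (f x ^ 2) +
        ENNReal.ofReal l⁻¹ * ENNReal.ofReal (v y ^ 2) := fun x y => by
    rw [← ENNReal.ofReal_mul (hv0 y), ← ENNReal.ofReal_mul hl.le,
      ← ENNReal.ofReal_mul (inv_pos.2 hl).le, ← ENNReal.ofReal_add (by positivity) (by positivity)]
    refine ENNReal.ofReal_le_ofReal ?_
    have h2 : l * f x ^ 2 + l⁻¹ * v y ^ 2 - v y * f x =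
        l⁻¹ * ((l * f x - v y) ^ 2 + (l * f x) * v y) := by
      field_simp
      ring
    have : 0 ≤ l⁻¹ * ((l * f x - v y) ^ 2 + (l * f x) * v y) := by
      have := mul_nonneg (mul_nonneg hl.le (hf0 x)) (hv0 y)
      positivity
    linarith
  calc _ = ∫⁻ x, ∫⁻ y, chain (fun t => ENNReal.ofReal (E t)) k x 0 y 0 *
        (ENNReal.ofReal (v y) * ENNReal.ofReal (f x)) := by
        refine lintegral_congr fun x => ?_
        have := hchx x
        rw [← lintegral_mul_const _ (by fun_prop)]
        simp_rw [mul_assoc]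
    _ ≤ ∫⁻ x, ∫⁻ y, (chain (fun t => ENNReal.ofReal (E t)) k x 0 y 0 *
        (ENNReal.ofReal l * ENNReal.ofReal (f x ^ 2)) +
        chain (fun t => ENNReal.ofReal (E t)) k x 0 y 0 *
        (ENNReal.ofReal l⁻¹ * ENNReal.ofReal (v y ^ 2))) := by
        refine lintegral_mono fun x => lintegral_mono fun y => ?_
        rw [← mul_add]
        exact mul_le_mul_right (young x y) _
    _ = (∫⁻ x, ∫⁻ y, chain (fun t => ENNReal.ofReal (E t)) k x 0 y 0 *
        (ENNReal.ofReal l * ENNReal.ofReal (f x ^ 2))) +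
        ∫⁻ x, ∫⁻ y, chain (fun t => ENNReal.ofReal (E t)) k x 0 y 0 *
        (ENNReal.ofReal l⁻¹ * ENNReal.ofReal (v y ^ 2)) := by
        rw [← lintegral_add_left]
        · refine lintegral_congr fun x => ?_
          have := hchx x
          rw [lintegral_add_left (by fun_prop)]
        · exact Measurable.lintegral_prod_right' (f := fun p : ℝ × ℝ =>
            chain (fun t => ENNReal.ofReal (E t)) k p.1 0 p.2 0 *
              (ENNReal.ofReal l * ENNReal.ofReal (f p.1 ^ 2))) (hch.mul (by fun_prop))
    _ ≤ _ := by
        refine add_le_add (le_of_eq ?_) ?_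
        · have : Measurable fun x : ℝ =>
              ENNReal.ofReal (weightedDensity E (k + 1) ((k + 2) * x)) :=
            hwm.comp (measurable_const_mul ((k : ℝ) + 2))
          rw [← lintegral_const_mul _ (by fun_prop)]
          refine lintegral_congr fun x => ?_
          rw [lintegral_mul_const _ (hchx x), lintegral_chain_endpoint hn hc hM hE h1,
            sub_zero, sub_zero]
          ring
        · rw [lintegral_lintegral_swap (Measurable.aemeasurable (hch.mul (by fun_prop))),
            ← lintegral_const_mul _ (by fun_prop)]
          refine lintegral_mono fun y => ?_
          rw [lintegral_mul_const _ (hchy y), lintegral_chain_startpoint hn hc hM hE h1,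
            ENNReal.ofReal_mul (inv_pos.2 hl).le, mul_comm (ENNReal.ofReal l⁻¹) (ENNReal.ofReal D),
            mul_assoc]
          exact mul_le_mul_left (ENNReal.ofReal_le_ofReal (hD _)) _

theorem tsum_lintegral_chain_mul_log_lt_top (hn : ∀ x, 0 ≤ E x) (hc : Continuous E)
    (hM : ∀ x, E x ≤ M) (hE : Integrable E) (h1 : ∫ x, E x = 1) (h0 : 0 < E 0)
    (hmom : Integrable fun x => x * E x) {v : ℝ → ℝ} (hv : Measurable v) (hv0 : ∀ y, 0 ≤ v y)
    (hv2 : ∫⁻ y, ENNReal.ofReal (v y ^ 2) < ⊤) :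
    ∑' k : ℕ, ∫⁻ x,
      (∫⁻ y, chain (fun t => ENNReal.ofReal (E t)) k x 0 y 0 * ENNReal.ofReal (v y)) *
        ENNReal.ofReal (Real.log (max (x ^ 2) 1)) < ⊤ := by
  obtain ⟨A, hA0, hA⟩ := exists_weightedDensity_le hn hc hM hE h1 h0
  obtain ⟨B, hB0, hB⟩ := exists_lintegral_weightedDensity_mul_log_sq_le hn hc hM hE h1 hmom
  set W := ∫⁻ y, ENNReal.ofReal (v y ^ 2) with hW
  have hbound : ∀ k : ℕ, ∫⁻ x,
      (∫⁻ y, chain (fun t => ENNReal.ofReal (E t)) k x 0 y 0 * ENNReal.ofReal (v y)) *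
        ENNReal.ofReal (Real.log (max (x ^ 2) 1)) ≤
      ENNReal.ofReal (((k + 2 : ℕ) : ℝ) ^ (-(17 / 16) : ℝ)) *
        (ENNReal.ofReal B + ENNReal.ofReal (4 * A) * W) := fun k => by
    push_cast
    set s : ℝ := (k : ℝ) + 2 with hs
    have hs1 : 1 ≤ s := by rw [hs]; linarith [Nat.cast_nonneg (α := ℝ) k]
    have hs0 : 0 < s := by linarith
    refine (lintegral_chain_mul_le hn hc hM hE h1 k (f := fun x => Real.log (max (x ^ 2) 1))
      (by fun_prop) hv (l := s ^ (-(1 / 8) : ℝ)) (by positivity) (hA k) hv0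
      log_max_sq_nonneg).trans ?_
    rw [mul_add, ← mul_assoc _ _ W]
    refine add_le_add ?_ (mul_le_mul_left ?_ _)
    · refine (mul_le_mul_right (hB k) _).trans (le_of_eq ?_)
      rw [← ENNReal.ofReal_mul (by positivity), ← ENNReal.ofReal_mul (by positivity)]
      congr 1
      have : s ^ (-(17 / 16) : ℝ) = s ^ (-(1 / 8) : ℝ) * s ^ (-(15 / 16) : ℝ) := by
        rw [← Real.rpow_add hs0]; norm_num
      rw [this]
      ring
    · rw [← ENNReal.ofReal_mul (by positivity)]
      refine ENNReal.ofReal_le_ofReal ?_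
      have hk : ((k : ℝ) + 1) ^ (-(5 / 4) : ℝ) ≤ 4 * s ^ (-(5 / 4) : ℝ) := by
        have hle : s / 2 ≤ (k : ℝ) + 1 := by
          rw [hs]; linarith [Nat.cast_nonneg (α := ℝ) k]
        refine (Real.rpow_le_rpow_of_nonpos (by positivity) hle (by norm_num)).trans ?_
        rw [Real.div_rpow hs0.le (by norm_num), div_eq_mul_inv, mul_comm,
          ← Real.rpow_neg (by norm_num)]
        refine mul_le_mul_of_nonneg_right ?_ (by positivity)
        calc (2 : ℝ) ^ (-(-(5 / 4)) : ℝ) ≤ 2 ^ (2 : ℝ) :=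
              Real.rpow_le_rpow_of_exponent_le (by norm_num) (by norm_num)
          _ = 4 := by norm_num
      rw [← Real.rpow_neg hs0.le]
      calc s ^ (-(-(1 / 8)) : ℝ) * (A * ((k : ℝ) + 1) ^ (-(5 / 4) : ℝ))
          ≤ s ^ (-(-(1 / 8)) : ℝ) * (A * (4 * s ^ (-(5 / 4) : ℝ))) := by gcongr
        _ = s ^ (-(9 / 8) : ℝ) * (4 * A) := by
            have : s ^ (-(9 / 8) : ℝ) = s ^ (-(-(1 / 8)) : ℝ) * s ^ (-(5 / 4) : ℝ) := by
              rw [← Real.rpow_add hs0]; norm_num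
            rw [this]
            ring
        _ ≤ _ := mul_le_mul_of_nonneg_right
            (Real.rpow_le_rpow_of_exponent_le hs1 (by norm_num)) (by positivity)
  refine (ENNReal.tsum_le_tsum hbound).trans_lt ?_
  rw [ENNReal.tsum_mul_right]
  refine ENNReal.mul_lt_top ?_ ?_
  · have hsum : Summable fun k : ℕ => ((k + 2 : ℕ) : ℝ) ^ (-(17 / 16) : ℝ) :=
      (summable_nat_add_iff 2).2 (Real.summable_nat_rpow.2 (by norm_num))
    rw [← ENNReal.ofReal_tsum_of_nonneg (fun k => by positivity) hsum]
    exact ENNReal.ofReal_lt_top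
  · exact ENNReal.add_lt_top.2
      ⟨ENNReal.ofReal_lt_top, ENNReal.mul_lt_top ENNReal.ofReal_lt_top hv2⟩

theorem ofReal_tsum_le_tsum_ofReal {f : ℕ → ℝ} (hf : ∀ n, 0 ≤ f n) :
    ENNReal.ofReal (∑' n, f n) ≤ ∑' n, ENNReal.ofReal (f n) := by
  by_cases h : Summable f
  · rw [ENNReal.ofReal_tsum_of_nonneg hf h]
  · simp [tsum_eq_zero_of_not_summable h]

theorem ofReal_integral_fpin_one_le (hn : ∀ x, 0 ≤ E x) {v : ℝ → ℝ} (hv0 : ∀ y, 0 ≤ v y) (x : ℝ) :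
    ENNReal.ofReal (∫ y, fpin E x y 1 * v y ∂muK) ≤
      ENNReal.ofReal (E x) * ENNReal.ofReal (v 0) := by
  refine (ofReal_integral_le_lintegral _ fun y => mul_nonneg (fpin_nonneg hn x y 1) (hv0 y)).trans
    (le_of_eq ?_)
  rw [muK, lintegral_add_measure, lintegral_dirac]
  have hz : ∫⁻ y, ENNReal.ofReal (fpin E x y 1 * v y) = 0 := by
    rw [lintegral_eq_zero_of_ae_eq_zero]
    have : ∀ᵐ y : ℝ, y ≠ 0 := by simp [ae_iff]
    filter_upwards [this] with y hy
    simp [fpin, hy]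
  rw [hz, add_zero, ← ENNReal.ofReal_mul (hn x)]
  simp [fpin]

theorem ofReal_integral_fpin_add_two_le (hn : ∀ x, 0 ≤ E x) (hE : Measurable E) {v : ℝ → ℝ}
    (hv0 : ∀ y, 0 ≤ v y) (k : ℕ) (x : ℝ) :
    ENNReal.ofReal (∫ y, fpin E x y (k + 2) * v y ∂muK) ≤
      ∫⁻ y, chain (fun t => ENNReal.ofReal (E t)) k x 0 y 0 * ENNReal.ofReal (v y) := by
  refine (ofReal_integral_le_lintegral _
    fun y => mul_nonneg (fpin_nonneg hn x y (k + 2)) (hv0 y)).trans ?_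
  rw [muK, lintegral_add_measure, lintegral_dirac]
  have hz : fpin E x 0 (k + 2) = 0 := by simp [fpin]
  rw [hz, zero_mul, ENNReal.ofReal_zero, zero_add]
  refine lintegral_mono fun y => ?_
  rw [ENNReal.ofReal_mul (fpin_nonneg hn x y _)]
  exact mul_le_mul_left (ofReal_fpin_le_chain hn hE x y k) _

end SubEigenfunction

/-- Equation (6.5): logarithmic moment of sub-eigenfunctions: if `v ≥ 0` is in `L²(ℝ, μ)`
and `v(x) ≤ C ∑_{n ∈ ℕ} ∫ f^p_{x,y}(n) v(y) μ(dy)` for all `x`, then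
`∫ v(x) log(x² ∨ 1) μ(dx) < ∞`. -/
theorem log_moment_of_subeigenfunction
    (E : ℝ → ℝ) (σ : ℝ)
    (hE_nonneg : ∀ x, 0 ≤ E x) (hE_cont : Continuous E)
    (hE_bdd : ∃ M, ∀ x, E x ≤ M) (hE_pos : 0 < E 0)
    (hE_int : Integrable E) (hE_mass : ∫ x, E x = 1)
    (hE_mom1 : Integrable fun x => x * E x) (hE_mean : ∫ x, x * E x = 0)
    (hE_mom2 : Integrable fun x => x ^ 2 * E x) (hE_var : ∫ x, x ^ 2 * E x = σ ^ 2)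
    (hσ : 0 < σ)
    (v : ℝ → ℝ) (hv_meas : Measurable v) (hv_nonneg : ∀ x, 0 ≤ v x)
    (hv_L2 : ∫⁻ x, ENNReal.ofReal (v x ^ 2) ∂muK < ⊤)
    (C : ℝ) (hC : 0 < C)
    (hv_sub : ∀ x : ℝ, v x ≤ C * ∑' n : ℕ, ∫ y, fpin E x y (n + 1) * v y ∂muK) :
    ∫⁻ x, ENNReal.ofReal (v x * Real.log (max (x ^ 2) 1)) ∂muK < ⊤ := by
  obtain ⟨M, hM⟩ := hE_bdd
  set e : ℝ → ℝ≥0∞ := fun t => ENNReal.ofReal (E t) with he_def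
  have he : Measurable e := by fun_prop
  set L : ℝ → ℝ≥0∞ := fun x => ENNReal.ofReal (Real.log (max (x ^ 2) 1)) with hL
  have hLm : Measurable L := by fun_prop
  set I : ℕ → ℝ → ℝ≥0∞ := fun k x => ∫⁻ y, chain e k x 0 y 0 * ENNReal.ofReal (v y) with hI
  have hIm : ∀ k, Measurable (I k) := fun k =>
    Measurable.lintegral_prod_right' (f := fun p : ℝ × ℝ =>
      chain e k p.1 0 p.2 0 * ENNReal.ofReal (v p.2))
      ((Measurable.chain he k (by fun_prop) (by fun_prop) (by fun_prop) (by fun_prop)).mul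
        (by fun_prop))
  have hv2 : ∫⁻ y, ENNReal.ofReal (v y ^ 2) < ⊤ := by
    refine lt_of_le_of_lt ?_ hv_L2
    rw [muK, lintegral_add_measure]
    exact le_add_self
  have hbound : ∀ x, ENNReal.ofReal (v x) ≤
      ENNReal.ofReal C * (e x * ENNReal.ofReal (v 0) + ∑' k, I k x) := fun x => by
    refine (ENNReal.ofReal_le_ofReal (hv_sub x)).trans ?_
    rw [ENNReal.ofReal_mul hC.le]
    refine mul_le_mul_right ((ofReal_tsum_le_tsum_ofReal fun n => integral_nonneg fun y =>
      mul_nonneg (fpin_nonneg hE_nonneg x y _) (hv_nonneg y)).trans ?_) _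
    rw [tsum_eq_zero_add' ENNReal.summable]
    exact add_le_add (ofReal_integral_fpin_one_le hE_nonneg hv_nonneg x) (ENNReal.tsum_le_tsum
      fun k => ofReal_integral_fpin_add_two_le hE_nonneg hE_cont.measurable hv_nonneg k x)
  have hfirst : ∫⁻ x, e x * L x < ⊤ := by
    refine lt_of_le_of_lt (lintegral_mono fun x => ?_) hE_mom2.lintegral_lt_top
    rw [he_def, hL, ← ENNReal.ofReal_mul (hE_nonneg x), mul_comm]
    exact ENNReal.ofReal_le_ofReal
      (mul_le_mul_of_nonneg_right (log_max_sq_le x) (hE_nonneg x))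
  have hrest := tsum_lintegral_chain_mul_log_lt_top hE_nonneg hE_cont hM hE_int hE_mass hE_pos
    hE_mom1 hv_meas hv_nonneg hv2
  rw [muK, lintegral_add_measure, lintegral_dirac]
  have hz : ENNReal.ofReal (v 0 * Real.log (max (0 ^ 2) 1)) = 0 := by simp
  rw [hz, zero_add]
  calc ∫⁻ x, ENNReal.ofReal (v x * Real.log (max (x ^ 2) 1))
      ≤ ∫⁻ x, ENNReal.ofReal C * (ENNReal.ofReal (v 0) * (e x * L x) + ∑' k, I k x * L x) := by
        refine lintegral_mono fun x => ?_
        rw [ENNReal.ofReal_mul (hv_nonneg x)]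
        refine (mul_le_mul_left (hbound x) _).trans (le_of_eq ?_)
        rw [ENNReal.tsum_mul_right]
        ring
    _ = ENNReal.ofReal C * (ENNReal.ofReal (v 0) * (∫⁻ x, e x * L x) +
        ∑' k, ∫⁻ x, I k x * L x) := by
        rw [lintegral_const_mul _ (by fun_prop), lintegral_add_left (by fun_prop),
          lintegral_const_mul _ (by fun_prop),
          lintegral_tsum (f := fun k x => I k x * L x) fun k => ((hIm k).mul hLm).aemeasurable]
    _ < ⊤ := ENNReal.mul_lt_top ENNReal.ofReal_lt_top
        (ENNReal.add_lt_top.2 ⟨ENNReal.mul_lt_top ENNReal.ofReal_lt_top hfirst, hrest⟩)
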